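/- arXiv:2010.04450 — 7 statements merged into one kernel-verified Lean document; each statement's English description precedes it below -/
import Mathlib

section
/- For any finite graph G with at least one edge, the orientation covering number of G equals the orientation covering number of the complete graph on χ(G) vertices, i.e. σ(G) = σ(K_{χ(G)}). -/
open SimpleGraph

/-- `o` is an orientation of the simple graph `G`: every oriented pair is an edge of `G`,
and every edge `{x,y}` of `G` receives exactly one of the two directions. -/
def IsOrientation {V : Type*} (G : SimpleGraph V) (o : V → V → Prop) : Prop :=
  (∀ x y, o x y → G.Adj x y) ∧ ∀ x y, G.Adj x y → (o x y ↔ ¬ o y x)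

/-- The list of orientations `o 1, …, o k` of `G` is an orientation covering of `G`:
each `o i` is an orientation of `G`, and whenever `xy, xz ∈ E(G)` there is some `i`
in which both `xy` and `xz` are oriented away from `x`. -/
def IsOrientationCovering {V : Type*} (G : SimpleGraph V) {k : ℕ}
    (o : Fin k → V → V → Prop) : Prop :=
  (∀ i, IsOrientation G (o i)) ∧
    ∀ x y z, G.Adj x y → G.Adj x z → ∃ i, o i x y ∧ o i x z

/-- The orientation covering number `σ(G)`: the smallest positive `k` for which there
exist `k` orientations of `G` forming an orientation covering of `G`. -/
noncomputable def orCov {V : Type*} (G : SimpleGraph V) : ℕ :=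
  sInf {k : ℕ | 0 < k ∧ ∃ o : Fin k → V → V → Prop, IsOrientationCovering G o}

/-- A family `𝒜` of subsets of `[k]` is intersecting if any two of its members meet. -/
def IntersectingFam {k : ℕ} (𝒜 : Finset (Finset (Fin k))) : Prop :=
  ∀ S ∈ 𝒜, ∀ T ∈ 𝒜, (S ∩ T).Nonempty

/-- A family `𝒜` of subsets of `[k]` is maximal intersecting if it is intersecting and is
not properly contained in any intersecting family of subsets of `[k]`. -/
def MaxIntersectingFam {k : ℕ} (𝒜 : Finset (Finset (Fin k))) : Prop :=
  IntersectingFam 𝒜 ∧ ∀ ℬ : Finset (Finset (Fin k)), IntersectingFam ℬ → 𝒜 ⊆ ℬ → ℬ = 𝒜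

/-- `λ(k)`: the number of maximal intersecting families of subsets of `[k]`. -/
noncomputable def lambdaMI (k : ℕ) : ℕ :=
  Nat.card {𝒜 : Finset (Finset (Fin k)) // MaxIntersectingFam 𝒜}

/-- Every intersecting family is contained in a maximal intersecting family. -/
theorem IntersectingFam.exists_maxIntersectingFam {k : ℕ} {𝒜 : Finset (Finset (Fin k))}
    (h : IntersectingFam 𝒜) : ∃ ℬ, 𝒜 ⊆ ℬ ∧ MaxIntersectingFam ℬ := by
  obtain ⟨ℬ, hle, hmax⟩ := Finite.exists_le_maximal h
  exact ⟨ℬ, hle, hmax.prop, fun 𝒞 h𝒞 hsub => (hmax.eq_of_le h𝒞 hsub).symm⟩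

/-- A set that meets itself and every member of a maximal intersecting family belongs to it. -/
theorem MaxIntersectingFam.mem_of_forall_inter {k : ℕ} {𝒜 : Finset (Finset (Fin k))}
    (h : MaxIntersectingFam 𝒜) {S : Finset (Fin k)} (hS : S.Nonempty)
    (hmeet : ∀ T ∈ 𝒜, (S ∩ T).Nonempty) : S ∈ 𝒜 := by
  have hins : IntersectingFam (insert S 𝒜) := by
    intro A hA B hB
    rw [Finset.mem_insert] at hA hB
    rcases hA with hA | hA <;> rcases hB with hB | hB
    · simpa [hA, hB] using hS
    · simpa [hA] using hmeet B hB
    · simpa [hB, Finset.inter_comm] using hmeet A hA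
    · exact h.1 A hA B hB
  rw [← h.2 _ hins (Finset.subset_insert S 𝒜)]
  exact Finset.mem_insert_self S 𝒜

/-- A maximal intersecting family of subsets of a nonempty `[k]` contains `S` or its complement. -/
theorem MaxIntersectingFam.compl_mem {k : ℕ} (hk : 0 < k) {𝒜 : Finset (Finset (Fin k))}
    (h : MaxIntersectingFam 𝒜) {S : Finset (Fin k)} (hS : S ∉ 𝒜) : Sᶜ ∈ 𝒜 := by
  have : NeZero k := ⟨hk.ne'⟩
  rcases S.eq_empty_or_nonempty with rfl | hne
  · refine h.mem_of_forall_inter (by simp) fun T hT => ?_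
    simpa using h.1 T hT T hT
  · obtain ⟨T, hT, hST⟩ : ∃ T ∈ 𝒜, ¬(S ∩ T).Nonempty := by
      by_contra! hmeet
      exact hS (h.mem_of_forall_inter hne hmeet)
    have hsub : T ⊆ Sᶜ := by
      rw [Finset.not_nonempty_iff_eq_empty, ← Finset.disjoint_iff_inter_eq_empty] at hST
      exact Finset.subset_compl_iff_disjoint_left.2 hST
    refine h.mem_of_forall_inter ?_ fun U hU => ?_
    · simpa using (h.1 T hT T hT).mono (Finset.inter_subset_inter hsub hsub)
    · exact (h.1 T hT U hU).mono (Finset.inter_subset_inter_right hsub)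

/-- Distinct maximal intersecting families are separated by a set and its complement. -/
theorem MaxIntersectingFam.exists_mem_compl_mem {k : ℕ} (hk : 0 < k)
    {𝒜 ℬ : Finset (Finset (Fin k))} (h𝒜 : MaxIntersectingFam 𝒜) (hℬ : MaxIntersectingFam ℬ)
    (hne : 𝒜 ≠ ℬ) : ∃ S ∈ 𝒜, Sᶜ ∈ ℬ := by
  obtain ⟨S, hS, hS'⟩ : ∃ S ∈ 𝒜, S ∉ ℬ := by
    by_contra! hsub
    exact hne (h𝒜.2 ℬ hℬ.1 hsub).symm
  exact ⟨S, hS, hℬ.compl_mem hk hS'⟩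

/-- Separating sets of distinct maximal intersecting families can be chosen so that swapping the
two families replaces the set by its complement. -/
theorem exists_separating_maxIntersectingFam {k : ℕ} (hk : 0 < k) :
    ∃ S : {𝒜 : Finset (Finset (Fin k)) // MaxIntersectingFam 𝒜} →
        {𝒜 : Finset (Finset (Fin k)) // MaxIntersectingFam 𝒜} → Finset (Fin k),
      ∀ a b, a ≠ b → S a b ∈ a.1 ∧ S b a = (S a b)ᶜ := by
  classical
  have hex (a b : {𝒜 : Finset (Finset (Fin k)) // MaxIntersectingFam 𝒜}) :
      ∃ S, a ≠ b → S ∈ a.1 ∧ Sᶜ ∈ b.1 := by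
    by_cases hab : a = b
    · exact ⟨∅, fun h => absurd hab h⟩
    · obtain ⟨S, hS⟩ := a.2.exists_mem_compl_mem hk b.2 (Subtype.coe_ne_coe.2 hab)
      exact ⟨S, fun _ => hS⟩
  choose S hS using hex
  refine ⟨fun a b => if WellOrderingRel a b then S a b else (S b a)ᶜ, fun a b hab => ?_⟩
  rcases trichotomous_of WellOrderingRel a b with h | h | h
  · simpa [h, asymm_of WellOrderingRel h] using (hS a b hab).1
  · exact absurd h hab
  · simpa [h, asymm_of WellOrderingRel h] using (hS b a hab.symm).2

/-- A graph has an orientation covering by `k` orientations if and only if it can be properly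
coloured by the maximal intersecting families of subsets of `[k]`. -/
theorem exists_isOrientationCovering_iff_colorable {V : Type*} (G : SimpleGraph V) {k : ℕ}
    (hk : 0 < k) :
    (∃ o : Fin k → V → V → Prop, IsOrientationCovering G o) ↔ G.Colorable (lambdaMI k) := by
  classical
  rw [lambdaMI, Nat.card_eq_fintype_card]
  constructor
  · rintro ⟨o, ho, hcov⟩
    let S (x y : V) : Finset (Fin k) := {i | o i x y}
    have hint (x : V) : IntersectingFam {A | ∃ y, G.Adj x y ∧ S x y = A} := by
      intro A hA B hB
      obtain ⟨y, hy, rfl⟩ := (Finset.mem_filter.1 hA).2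
      obtain ⟨z, hz, rfl⟩ := (Finset.mem_filter.1 hB).2
      obtain ⟨i, hi⟩ := hcov x y z hy hz
      exact ⟨i, by simpa [S] using hi⟩
    choose F hF hmax using fun x => (hint x).exists_maxIntersectingFam
    have hmem {x y : V} (hxy : G.Adj x y) : S x y ∈ F x :=
      hF x (Finset.mem_filter.2 ⟨Finset.mem_univ _, y, hxy, rfl⟩)
    let c : G.Coloring {𝒜 : Finset (Finset (Fin k)) // MaxIntersectingFam 𝒜} :=
      Coloring.mk (fun x => ⟨F x, hmax x⟩) fun {x y} hxy heq => by
        have hyx : S y x ∈ F x := by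
          rw [show F x = F y from congrArg Subtype.val heq]
          exact hmem hxy.symm
        obtain ⟨i, hi⟩ := (hmax x).1 _ (hmem hxy) _ hyx
        have hi' : o i x y ∧ o i y x := by simpa [S] using hi
        exact ((ho i).2 x y hxy).1 hi'.1 hi'.2
    exact c.colorable
  · intro h
    let c := h.toColoring le_rfl
    obtain ⟨S, hS⟩ := exists_separating_maxIntersectingFam hk
    refine ⟨fun i x y => G.Adj x y ∧ i ∈ S (c x) (c y), fun i => ⟨fun x y h => h.1, ?_⟩, ?_⟩
    · intro x y hxy
      simp [hxy, hxy.symm, (hS _ _ (c.valid hxy)).2]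
    · intro x y z hy hz
      obtain ⟨i, hi⟩ := (c x).2.1 _ (hS _ _ (c.valid hy)).1 _ (hS _ _ (c.valid hz)).1
      rw [Finset.mem_inter] at hi
      exact ⟨i, ⟨hy, hi.1⟩, hz, hi.2⟩

/-- For any finite graph `G` with at least one edge, `σ(G) = σ(K_{χ(G)})`. -/
theorem orCov_eq_orCov_completeGraph_chromaticNumber
    {V : Type*} [Fintype V] (G : SimpleGraph V) (hG : ∃ u v, G.Adj u v)
    (n : ℕ) (hn : G.chromaticNumber = (n : ℕ∞)) :
    orCov G = orCov (⊤ : SimpleGraph (Fin n)) := by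
  unfold orCov
  congr 1
  ext k
  refine and_congr_right fun hk => ?_
  rw [exists_isOrientationCovering_iff_colorable G hk,
    exists_isOrientationCovering_iff_colorable _ hk, ← chromaticNumber_le_iff_colorable,
    ← chromaticNumber_le_iff_colorable, hn, chromaticNumber_top, Fintype.card_fin]
end

section
/- For any finite graph G with at least one edge, σ(G) ≤ σ(K_{χ(G)}). -/
open SimpleGraph

theorem IsOrientationCovering.comap {V W : Type*} {G : SimpleGraph V} {H : SimpleGraph W}
    (f : G →g H) {k : ℕ} {o : Fin k → W → W → Prop} (ho : IsOrientationCovering H o) :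
    IsOrientationCovering G fun i x y => G.Adj x y ∧ o i (f x) (f y) := by
  refine ⟨fun i => ⟨fun x y h => h.1, fun x y h => ?_⟩, fun x y z hy hz => ?_⟩
  · simpa [h, h.symm] using (ho.1 i).2 _ _ (f.map_adj h)
  · obtain ⟨i, h₁, h₂⟩ := ho.2 _ _ _ (f.map_adj hy) (f.map_adj hz)
    exact ⟨i, ⟨hy, h₁⟩, hz, h₂⟩

/-- The orientations of `K_n` in which one vertex is moved in front of the usual linear order
form an orientation covering. -/
theorem isOrientationCovering_completeGraph (n : ℕ) :
    IsOrientationCovering (⊤ : SimpleGraph (Fin n))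
      fun w x y => x ≠ y ∧ (x = w ∨ y ≠ w ∧ x < y) := by
  refine ⟨fun w => ⟨fun x y h => h.1, fun x y h => ?_⟩, fun x y z hy hz => ?_⟩
  · rw [top_adj] at h
    grind
  · exact ⟨x, ⟨hy, Or.inl rfl⟩, hz, Or.inl rfl⟩

/-- For any finite graph `G` with at least one edge, `σ(G) ≤ σ(K_{χ(G)})`. -/
theorem orCov_le_orCov_completeGraph_chromaticNumber
    {V : Type*} [Fintype V] (G : SimpleGraph V) (hG : ∃ u v, G.Adj u v)
    (n : ℕ) (hn : G.chromaticNumber = (n : ℕ∞)) :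
    orCov G ≤ orCov (⊤ : SimpleGraph (Fin n)) := by
  obtain ⟨c⟩ := chromaticNumber_le_iff_colorable.mp hn.le
  obtain ⟨u, -⟩ := hG
  obtain ⟨hpos, o, ho⟩ := Nat.sInf_mem
    (s := {k : ℕ | 0 < k ∧ ∃ o : Fin k → Fin n → Fin n → Prop, IsOrientationCovering ⊤ o})
    ⟨n, (c u).pos, _, isOrientationCovering_completeGraph n⟩
  exact Nat.sInf_le ⟨hpos, _, ho.comap c⟩
end

section
/- For any finite graph G with at least one edge, σ(G) is the smallest positive integer k with the following property: there exists a collection (𝒜_v)_{v ∈ V(G)} with each 𝒜_v a family of subsets of [k], such that (1) whenever uv ∈ E(G), there exist S ∈ 𝒜_u and T ∈ 𝒜_v with S ∩ T = ∅, and (2) for every vertex v, the family 𝒜_v is intersecting. -/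
open SimpleGraph

/-- The out-neighbourhood index sets `{i | o i v w}` of an orientation covering form intersecting
families that are pairwise disjointly represented along edges. -/
theorem IsOrientationCovering.exists_families {V : Type*} [Fintype V] {G : SimpleGraph V} {k : ℕ}
    {o : Fin k → V → V → Prop} (h : IsOrientationCovering G o) :
    ∃ 𝒜 : V → Finset (Finset (Fin k)),
      (∀ u v, G.Adj u v → ∃ S ∈ 𝒜 u, ∃ T ∈ 𝒜 v, S ∩ T = ∅) ∧ ∀ v, IntersectingFam (𝒜 v) := by
  classical
  let out : V → V → Finset (Fin k) := fun v w ↦ {i | o i v w}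
  refine ⟨fun v ↦ ({w | G.Adj v w} : Finset V).image (out v), fun u v huv ↦ ?_, fun v ↦ ?_⟩
  · refine ⟨out u v, Finset.mem_image_of_mem _ (by simpa using huv),
      out v u, Finset.mem_image_of_mem _ (by simpa using huv.symm), ?_⟩
    ext i
    have := (h.1 i).2 u v huv
    simp only [out, Finset.mem_inter, Finset.mem_filter_univ, Finset.notMem_empty]
    tauto
  · intro S hS T hT
    simp only [Finset.mem_image, Finset.mem_filter_univ] at hS hT
    obtain ⟨y, hy, rfl⟩ := hS
    obtain ⟨z, hz, rfl⟩ := hT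
    obtain ⟨i, hi⟩ := h.2 v y z hy hz
    exact ⟨i, by simpa [out] using hi⟩

/-- Intersecting families containing disjoint members along every edge yield an orientation
covering. -/
theorem exists_isOrientationCovering_of_families {V : Type*} {G : SimpleGraph V} {k : ℕ}
    {𝒜 : V → Finset (Finset (Fin k))}
    (hdisj : ∀ u v, G.Adj u v → ∃ S ∈ 𝒜 u, ∃ T ∈ 𝒜 v, S ∩ T = ∅)
    (hint : ∀ v, IntersectingFam (𝒜 v)) :
    ∃ o : Fin k → V → V → Prop, IsOrientationCovering G o := by
  classical
  let : LinearOrder V := IsWellOrder.linearOrder WellOrderingRel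
  choose! S hS T hT hST using hdisj
  let o : Fin k → V → V → Prop := fun i x y ↦
    G.Adj x y ∧ (x < y ∧ i ∈ S x y ∨ y < x ∧ i ∉ S y x)
  have out_of_mem : ∀ x y, G.Adj x y → ∃ U ∈ 𝒜 x, ∀ i ∈ U, o i x y := by
    intro x y hxy
    rcases lt_or_gt_of_ne hxy.ne with hlt | hlt
    · exact ⟨S x y, hS x y hxy, fun i hi ↦ ⟨hxy, .inl ⟨hlt, hi⟩⟩⟩
    · refine ⟨T y x, hT y x hxy.symm, fun i hi ↦ ⟨hxy, .inr ⟨hlt, fun hi' ↦ ?_⟩⟩⟩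
      simpa [hST y x hxy.symm] using Finset.mem_inter.2 ⟨hi', hi⟩
  refine ⟨o, fun i ↦ ⟨fun x y h ↦ h.1, fun x y hxy ↦ ?_⟩, fun x y z hxy hxz ↦ ?_⟩
  · rcases lt_or_gt_of_ne hxy.ne with hlt | hlt <;>
      simp [o, hxy, hxy.symm, hlt, hlt.not_gt]
  · obtain ⟨U, hU, hUo⟩ := out_of_mem x y hxy
    obtain ⟨W, hW, hWo⟩ := out_of_mem x z hxz
    obtain ⟨i, hi⟩ := hint x U hU W hW
    rw [Finset.mem_inter] at hi
    exact ⟨i, hUo i hi.1, hWo i hi.2⟩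

/-- Principal families on `[|V|]` are intersecting and contain disjoint members along edges. -/
theorem exists_families_card {V : Type*} [Fintype V] (G : SimpleGraph V) :
    ∃ 𝒜 : V → Finset (Finset (Fin (Fintype.card V))),
      (∀ u v, G.Adj u v → ∃ S ∈ 𝒜 u, ∃ T ∈ 𝒜 v, S ∩ T = ∅) ∧ ∀ v, IntersectingFam (𝒜 v) := by
  let e := Fintype.equivFin V
  refine ⟨fun v ↦ {{e v}}, fun u v huv ↦ ?_, fun v ↦ ?_⟩
  · simpa [← Finset.disjoint_iff_inter_eq_empty] using huv.ne.symm
  · simp [IntersectingFam]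

/-- `σ(G)` is the smallest positive `k` such that there is a collection `(𝒜 v)` of
families of subsets of `[k]` with: (1) whenever `uv ∈ E(G)` there are `S ∈ 𝒜 u`,
`T ∈ 𝒜 v` with `S ∩ T = ∅`, and (2) each `𝒜 v` is intersecting. -/
theorem orCov_isLeast_families
    {V : Type*} [Fintype V] (G : SimpleGraph V) (hG : ∃ u v, G.Adj u v) :
    IsLeast {k : ℕ | 0 < k ∧ ∃ 𝒜 : V → Finset (Finset (Fin k)),
        (∀ u v, G.Adj u v → ∃ S ∈ 𝒜 u, ∃ T ∈ 𝒜 v, S ∩ T = ∅) ∧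
        (∀ v, IntersectingFam (𝒜 v))}
      (orCov G) := by
  have key : {k : ℕ | 0 < k ∧ ∃ 𝒜 : V → Finset (Finset (Fin k)),
        (∀ u v, G.Adj u v → ∃ S ∈ 𝒜 u, ∃ T ∈ 𝒜 v, S ∩ T = ∅) ∧
        (∀ v, IntersectingFam (𝒜 v))} =
      {k : ℕ | 0 < k ∧ ∃ o : Fin k → V → V → Prop, IsOrientationCovering G o} := by
    ext k
    exact and_congr_right fun _ ↦
      ⟨fun ⟨_, hdisj, hint⟩ ↦ exists_isOrientationCovering_of_families hdisj hint,
        fun ⟨_, h⟩ ↦ h.exists_families⟩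
  obtain ⟨u, -, -⟩ := hG
  rw [orCov, ← key]
  exact ⟨Nat.sInf_mem ⟨_, Fintype.card_pos_iff.2 ⟨u⟩, exists_families_card G⟩,
    fun _ hk ↦ Nat.sInf_le hk⟩
end

section
/- Let G be a finite graph with at least one edge and suppose that the orientations G⃗₁,…,G⃗ₖ form an orientation covering of G. Then there exists a collection (𝒜_v)_{v ∈ V(G)} with each 𝒜_v a family of subsets of [k], such that (1) whenever uv ∈ E(G), there exist S ∈ 𝒜_u and T ∈ 𝒜_v with S ∩ T = ∅, and (2) for every vertex v, the family 𝒜_v is intersecting. -/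
open SimpleGraph

/-- If `o 1, …, o k` form an orientation covering of a finite graph `G` with at least
one edge, then there is a collection `(𝒜 v)` of families of subsets of `[k]` with:
(1) whenever `uv ∈ E(G)` there are `S ∈ 𝒜 u`, `T ∈ 𝒜 v` with `S ∩ T = ∅`, and
(2) each `𝒜 v` is intersecting. -/
theorem exists_families_of_isOrientationCovering
    {V : Type*} [Fintype V] (G : SimpleGraph V) (hG : ∃ u v, G.Adj u v)
    (k : ℕ) (o : Fin k → V → V → Prop) (ho : IsOrientationCovering G o) :
    ∃ 𝒜 : V → Finset (Finset (Fin k)),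
      (∀ u v, G.Adj u v → ∃ S ∈ 𝒜 u, ∃ T ∈ 𝒜 v, S ∩ T = ∅) ∧
      (∀ v, IntersectingFam (𝒜 v)) := by
  classical
  let out (x y : V) : Finset (Fin k) := {i | o i x y}
  refine ⟨fun v => {S | ∃ y, G.Adj v y ∧ out v y = S}, fun u v huv => ?_, fun v S hS T hT => ?_⟩
  · refine ⟨out u v, by simpa using ⟨v, huv, rfl⟩, out v u, by simpa using ⟨u, huv.symm, rfl⟩, ?_⟩
    ext i
    simpa [out] using ((ho.1 i).2 u v huv).1
  · simp only [Finset.mem_filter_univ] at hS hT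
    obtain ⟨y, hy, rfl⟩ := hS
    obtain ⟨z, hz, rfl⟩ := hT
    obtain ⟨i, hiy, hiz⟩ := ho.2 v y z hy hz
    exact ⟨i, by simp [out, hiy, hiz]⟩
end

section
/- Let G be a finite graph with at least one edge, let k be a positive integer, and suppose there exists a collection (𝒜_v)_{v ∈ V(G)} with each 𝒜_v a family of subsets of [k], such that (1) whenever uv ∈ E(G), there exist S ∈ 𝒜_u and T ∈ 𝒜_v with S ∩ T = ∅, and (2) for every vertex v, the family 𝒜_v is intersecting. Then σ(G) ≤ k, i.e. there exist k orientations of G forming an orientation covering. -/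
open SimpleGraph

/-- If adjacent vertices have disjoint members in their families, then such members can be
chosen consistently over the two directions of each edge. -/
theorem exists_mem_disjoint_of_adj {V α : Type*} [Fintype V] [DecidableEq α]
    (G : SimpleGraph V) (𝒜 : V → Finset (Finset α))
    (h : ∀ u v, G.Adj u v → ∃ S ∈ 𝒜 u, ∃ T ∈ 𝒜 v, S ∩ T = ∅) :
    ∃ f : V → V → Finset α, (∀ u v, G.Adj u v → f u v ∈ 𝒜 u) ∧
      ∀ u v, G.Adj u v → Disjoint (f u v) (f v u) := by
  classical
  choose! S hS T hT hST using h
  let r := Fintype.equivFin V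
  refine ⟨fun u v => if r u < r v then S u v else T v u, fun u v huv => ?_, fun u v huv => ?_⟩
  · dsimp only
    split_ifs
    · exact hS u v huv
    · exact hT v u huv.symm
  · rw [Finset.disjoint_iff_inter_eq_empty]
    rcases lt_or_gt_of_ne (r.injective.ne huv.ne) with hlt | hlt
    · simpa [hlt, hlt.not_gt] using hST u v huv
    · simpa [hlt, hlt.not_gt, Finset.inter_comm] using hST v u huv.symm

/-- If there is a collection `(𝒜 v)` of families of subsets of `[k]` with:
(1) whenever `uv ∈ E(G)` there are `S ∈ 𝒜 u`, `T ∈ 𝒜 v` with `S ∩ T = ∅`, and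
(2) each `𝒜 v` is intersecting, then `σ(G) ≤ k`, i.e. there exist `k` orientations
of `G` forming an orientation covering. -/
theorem orCov_le_of_families
    {V : Type*} [Fintype V] (G : SimpleGraph V) (hG : ∃ u v, G.Adj u v)
    (k : ℕ) (hk : 0 < k) (𝒜 : V → Finset (Finset (Fin k)))
    (h1 : ∀ u v, G.Adj u v → ∃ S ∈ 𝒜 u, ∃ T ∈ 𝒜 v, S ∩ T = ∅)
    (h2 : ∀ v, IntersectingFam (𝒜 v)) :
    orCov G ≤ k ∧ ∃ o : Fin k → V → V → Prop, IsOrientationCovering G o := by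
  classical
  suffices h : ∃ o : Fin k → V → V → Prop, IsOrientationCovering G o from
    ⟨Nat.sInf_le ⟨hk, h⟩, h⟩
  obtain ⟨f, hmem, hdisj⟩ := exists_mem_disjoint_of_adj G 𝒜 h1
  let r := Fintype.equivFin V
  refine ⟨fun i x y => G.Adj x y ∧ (i ∈ f x y ∨ i ∉ f y x ∧ r x < r y),
    fun i => ⟨fun x y h => h.1, fun x y h => ?_⟩, fun x y z hy hz => ?_⟩
  · have hd : i ∈ f x y → i ∉ f y x := fun hi =>
      Finset.disjoint_left.mp (hdisj x y h) hi
    have hne : r x ≠ r y := r.injective.ne h.ne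
    have hs := h.symm
    rcases lt_or_gt_of_ne hne with hlt | hlt
    · have := hlt.not_gt
      tauto
    · have := hlt.not_gt
      tauto
  · obtain ⟨i, hi⟩ := h2 x _ (hmem x y hy) _ (hmem x z hz)
    rw [Finset.mem_inter] at hi
    exact ⟨i, ⟨hy, Or.inl hi.1⟩, ⟨hz, Or.inl hi.2⟩⟩
end

section
/- For any finite graph G with at least one edge, the number of maximal intersecting families of subsets of [σ(G)] is at least χ(G), i.e. λ(σ(G)) ≥ χ(G). -/
open SimpleGraph

theorem IntersectingFam.exists_maximal {k : ℕ} {𝒜 : Finset (Finset (Fin k))}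
    (h : IntersectingFam 𝒜) : ∃ ℬ, MaxIntersectingFam ℬ ∧ 𝒜 ⊆ ℬ := by
  obtain ⟨ℬ, hle, hmax⟩ := Finite.exists_le_maximal (p := IntersectingFam) h
  exact ⟨ℬ, ⟨hmax.prop, fun 𝒞 h𝒞 hsub => (hmax.eq_of_le h𝒞 hsub).symm⟩, hle⟩

open Classical in
/-- The sets of indices of the orientations in which the individual edges at `x` point
away from `x`. -/
noncomputable def outFam {V : Type*} [Fintype V] (G : SimpleGraph V) {k : ℕ}
    (o : Fin k → V → V → Prop) (x : V) : Finset (Finset (Fin k)) :=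
  (G.neighborFinset x).image fun y => ({i | o i x y} : Finset (Fin k))

theorem IsOrientationCovering.intersectingFam_outFam {V : Type*} [Fintype V]
    {G : SimpleGraph V} {k : ℕ} {o : Fin k → V → V → Prop}
    (h : IsOrientationCovering G o) (x : V) : IntersectingFam (outFam G o x) := by
  intro S hS T hT
  simp only [outFam, Finset.mem_image, mem_neighborFinset] at hS hT
  obtain ⟨y, hy, rfl⟩ := hS
  obtain ⟨z, hz, rfl⟩ := hT
  obtain ⟨i, hi⟩ := h.2 x y z hy hz
  exact ⟨i, by simpa using hi⟩

/-- Colour each vertex by a maximal intersecting family containing `outFam` at that vertex. -/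
theorem IsOrientationCovering.colorable {V : Type*} [Fintype V]
    {G : SimpleGraph V} {k : ℕ} {o : Fin k → V → V → Prop}
    (h : IsOrientationCovering G o) : G.Colorable (lambdaMI k) := by
  classical
  choose c hc hsub using fun x => (h.intersectingFam_outFam x).exists_maximal
  have : Fintype {𝒜 : Finset (Finset (Fin k)) // MaxIntersectingFam 𝒜} := Fintype.ofFinite _
  rw [lambdaMI, Nat.card_eq_fintype_card]
  refine (Coloring.mk (fun x => ⟨c x, hc x⟩) ?_).colorable
  intro x y hxy heq
  have heq : c x = c y := congrArg Subtype.val heq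
  have mem {u v : V} (huv : G.Adj u v) :
      ({i | o i u v} : Finset (Fin k)) ∈ c u :=
    hsub u (Finset.mem_image.2 ⟨v, by simpa using huv, by simp⟩)
  obtain ⟨i, hi⟩ := (hc y).1 _ (heq ▸ mem hxy) _ (mem hxy.symm)
  simp only [Finset.mem_inter, Finset.mem_filter, Finset.mem_univ, true_and] at hi
  exact ((h.1 i).2 x y hxy).1 hi.1 hi.2

/-- For each vertex `w`, orient all edges at `w` away from `w` and the others increasingly. -/
theorem exists_isOrientationCovering {V : Type*} [Fintype V] (G : SimpleGraph V) :
    ∃ o : Fin (Fintype.card V) → V → V → Prop, IsOrientationCovering G o := by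
  let e := Fintype.equivFin V
  refine ⟨fun i u v => G.Adj u v ∧ (e u = i ∨ (e v ≠ i ∧ e u < e v)),
    fun i => ⟨fun x y hxy => hxy.1, fun x y hxy => ?_⟩,
    fun x y z hy hz => ⟨e x, ⟨hy, .inl rfl⟩, hz, .inl rfl⟩⟩
  have hne : e x ≠ e y := e.injective.ne hxy.ne
  have hyx := hxy.symm
  grind

theorem isOrientationCovering_orCov {V : Type*} [Fintype V] [Nonempty V]
    (G : SimpleGraph V) :
    ∃ o : Fin (orCov G) → V → V → Prop, IsOrientationCovering G o :=
  (Nat.sInf_mem (s := {k : ℕ | 0 < k ∧ ∃ o : Fin k → V → V → Prop, IsOrientationCovering G o})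
    ⟨_, Fintype.card_pos, exists_isOrientationCovering G⟩).2

/-- For any finite graph `G` with at least one edge, `λ(σ(G)) ≥ χ(G)`. -/
theorem chromaticNumber_le_lambda_orCov
    {V : Type*} [Fintype V] (G : SimpleGraph V) (hG : ∃ u v, G.Adj u v)
    (n : ℕ) (hn : G.chromaticNumber = (n : ℕ∞)) :
    n ≤ lambdaMI (orCov G) := by
  obtain ⟨u, -⟩ := hG
  have : Nonempty V := ⟨u⟩
  obtain ⟨o, ho⟩ := isOrientationCovering_orCov G
  have hle := ho.colorable.chromaticNumber_le
  rw [hn] at hle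
  exact_mod_cast hle
end

section
/- There exists a function e : ℕ → ℝ with e(n) → 0 as n → ∞ such that for all sufficiently large n, σ(K_n) = ⌈log₂ log₂ n + (1/2)·log₂ log₂ log₂ n + (1/2)·(log₂ π + 1) + e(n)⌉. -/
open SimpleGraph

open Finset in
/-- If every subset of `W` of size exceeding `Z` has a vertex with at least `d` in-neighbours, then `W`
has at most `β ^ #W * 2 ^ Z` independent subsets. -/
theorem card_independent_le {α : Type*} [DecidableEq α] (r : α → α → Prop) [DecidableRel r]
    (hr : ∀ a, ¬ r a a) (d Z : ℕ) {β : ℝ} (hβ : 1 ≤ β) (hd : β ^ d + 1 ≤ β ^ (d + 1))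
    (W : Finset α)
    (h : ∀ W' ⊆ W, (∀ v ∈ W', #{u ∈ W' | r u v} < d) → #W' ≤ Z) :
    (#{I ∈ W.powerset | ∀ a ∈ I, ∀ b ∈ I, ¬ r a b} : ℝ) ≤ β ^ #W * 2 ^ Z := by
  induction W using Finset.strongInduction with
  | H W ih =>
    by_cases hW : ∀ v ∈ W, #{u ∈ W | r u v} < d
    · have h1 : #{I ∈ W.powerset | ∀ a ∈ I, ∀ b ∈ I, ¬ r a b} ≤ 2 ^ Z :=
        calc _ ≤ #W.powerset := card_filter_le _ _
          _ = 2 ^ #W := card_powerset _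
          _ ≤ 2 ^ Z := Nat.pow_le_pow_right (by norm_num) (h W subset_rfl hW)
      have h2 : (#{I ∈ W.powerset | ∀ a ∈ I, ∀ b ∈ I, ¬ r a b} : ℝ) ≤ 2 ^ Z := by
        exact_mod_cast h1
      exact h2.trans (le_mul_of_one_le_left (by positivity) (one_le_pow₀ hβ))
    · push Not at hW
      obtain ⟨v, hv, hdv⟩ := hW
      set D := {u ∈ W | r u v} with hD
      have hss1 : W.erase v ⊂ W := erase_ssubset hv
      have hss2 : W.erase v \ D ⊂ W := (sdiff_subset).trans_ssubset hss1
      have i1 := ih _ hss1 fun W' hW' => h W' (hW'.trans hss1.subset)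
      have i2 := ih _ hss2 fun W' hW' => h W' (hW'.trans hss2.subset)
      have hsplit : #{I ∈ W.powerset | ∀ a ∈ I, ∀ b ∈ I, ¬ r a b} ≤
          #{I ∈ (W.erase v).powerset | ∀ a ∈ I, ∀ b ∈ I, ¬ r a b} +
          #{I ∈ (W.erase v \ D).powerset | ∀ a ∈ I, ∀ b ∈ I, ¬ r a b} := by
        rw [← card_filter_add_card_filter_not (s := {I ∈ W.powerset | ∀ a ∈ I, ∀ b ∈ I, ¬ r a b})
          (fun I => v ∉ I)]
        refine Nat.add_le_add (card_le_card ?_) (card_le_card_of_injOn (fun I => I.erase v) ?_ ?_)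
        · intro I
          simp only [mem_filter, mem_powerset, subset_erase]
          tauto
        · intro I
          simp only [coe_filter, mem_filter, mem_powerset, Set.mem_ofPred_eq, not_not]
          rintro ⟨⟨hI, hind⟩, hvI⟩
          refine ⟨fun u hu => ?_, fun a ha b hb =>
            hind a (mem_of_mem_erase ha) b (mem_of_mem_erase hb)⟩
          have hu' := mem_of_mem_erase hu
          simp only [hD, mem_sdiff, mem_erase, mem_filter, not_and]
          exact ⟨⟨ne_of_mem_erase hu, hI hu'⟩, fun _ => hind u hu' v hvI⟩
        · intro I hI J hJ hIJ
          simp only [coe_filter, mem_filter, not_not, Set.mem_ofPred_eq] at hI hJ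
          rw [← insert_erase hI.2, ← insert_erase hJ.2]
          exact congrArg _ hIJ
      have hDsub : D ⊆ W.erase v := fun u hu => by
        simp only [hD, mem_filter] at hu
        exact mem_erase.2 ⟨fun e => hr v (e ▸ hu.2), hu.1⟩
      have hc1 : #(W.erase v) + 1 = #W := card_erase_add_one hv
      have hc2 : #(W.erase v \ D) + #D = #(W.erase v) := card_sdiff_add_card_eq_card hDsub
      obtain ⟨w, hw⟩ : ∃ w, #W = w + (d + 1) := ⟨#W - (d + 1), by omega⟩
      have e1 : #(W.erase v) = w + d := by omega
      have e2 : #(W.erase v \ D) ≤ w := by omega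
      have hZ : (0 : ℝ) < 2 ^ Z := by positivity
      calc (#{I ∈ W.powerset | ∀ a ∈ I, ∀ b ∈ I, ¬ r a b} : ℝ)
          ≤ β ^ #(W.erase v) * 2 ^ Z + β ^ #(W.erase v \ D) * 2 ^ Z := by
            refine le_trans ?_ (add_le_add i1 i2)
            exact_mod_cast hsplit
        _ ≤ β ^ (w + d) * 2 ^ Z + β ^ w * 2 ^ Z := by
            rw [e1]; gcongr
        _ = β ^ w * (β ^ d + 1) * 2 ^ Z := by ring
        _ ≤ β ^ w * β ^ (d + 1) * 2 ^ Z := by gcongr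
        _ = β ^ #W * 2 ^ Z := by rw [hw, pow_add β w]

open Finset in
theorem sum_ssubset_inv_choose {α : Type*} [DecidableEq α] (F : Finset (Finset α))
    (f : Finset α → ℝ) (S : Finset α) :
    ∑ A ∈ F with A ⊂ S, ((#S).choose #A : ℝ)⁻¹ * f A =
      (#S : ℝ)⁻¹ * ∑ x ∈ S, ∑ A ∈ F with A ⊆ S.erase x,
        ((#(S.erase x)).choose #A : ℝ)⁻¹ * f A := by
  have hswap : ∑ x ∈ S, ∑ A ∈ F with A ⊆ S.erase x,
        ((#(S.erase x)).choose #A : ℝ)⁻¹ * f A =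
      ∑ A ∈ F with A ⊂ S, ∑ x ∈ S \ A, ((#S - 1).choose #A : ℝ)⁻¹ * f A := by
    rw [sum_comm' (s' := fun A => S \ A) (t' := {A ∈ F | A ⊂ S})]
    · refine sum_congr rfl fun A _ => sum_congr rfl fun x hx => ?_
      rw [card_erase_of_mem (mem_sdiff.1 hx).1]
    · intro x A
      simp only [mem_filter, mem_sdiff, subset_erase, ssubset_iff_subset_ne]
      constructor
      · rintro ⟨hx, hA, hAS, hxA⟩
        exact ⟨⟨hx, hxA⟩, hA, hAS, fun e => hxA (e ▸ hx)⟩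
      · rintro ⟨⟨hx, hxA⟩, hA, hAS, -⟩
        exact ⟨hx, hA, hAS, hxA⟩
  rw [hswap, mul_sum]
  refine sum_congr rfl fun A hA => ?_
  have hAS := (mem_filter.1 hA).2
  have hlt := card_lt_card hAS
  rw [sum_const, card_sdiff_of_subset hAS.subset, nsmul_eq_mul, ← mul_assoc, ← mul_assoc]
  congr 1
  obtain ⟨s, hs⟩ : ∃ s, #S = s + 1 := ⟨#S - 1, by omega⟩
  rw [hs] at hlt ⊢
  have hk2 := Nat.choose_mul_succ_eq s #A
  have hpos : 0 < s.choose #A := Nat.choose_pos (by omega)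
  have hpos2 : 0 < (s + 1).choose #A := Nat.choose_pos (by omega)
  have hk3 : (s.choose #A : ℝ) * ((s : ℝ) + 1) = ((s + 1).choose #A : ℝ) * ((s + 1 - #A : ℕ) : ℝ) := by
    exact_mod_cast hk2
  have : (0 : ℝ) < s.choose #A := by exact_mod_cast hpos
  have : (0 : ℝ) < (s + 1).choose #A := by exact_mod_cast hpos2
  simp only [Nat.add_sub_cancel]
  push_cast
  field_simp
  linarith

open Finset in
/-- A LYM-type inequality for families that need not be antichains: on a random maximal chain of
subsets of `S`, the number of members of `F` minus the number of nested pairs averages at most `1`. -/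
theorem sum_inv_choose_mul_le_one {α : Type*} [DecidableEq α] (F : Finset (Finset α))
    (S : Finset α) :
    ∑ A ∈ F with A ⊆ S, ((#S).choose #A : ℝ)⁻¹ *
      (1 - ∑ C ∈ F with C ⊂ A, ((#A).choose #C : ℝ)⁻¹) ≤ 1 := by
  induction S using Finset.strongInduction with
  | H S ih =>
    set g : Finset α → ℝ := fun A => 1 - ∑ C ∈ F with C ⊂ A, ((#A).choose #C : ℝ)⁻¹ with hg
    have hg1 : ∀ A, g A ≤ 1 := fun A =>
      sub_le_self _ (sum_nonneg fun C _ => by positivity)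
    by_cases hS : S ∈ F
    · have : {A ∈ F | A ⊆ S} = insert S {A ∈ F | A ⊂ S} := by
        ext A
        simp only [mem_filter, mem_insert, subset_iff_ssubset_or_eq]
        constructor
        · tauto
        · rintro (rfl | h)
          · exact ⟨hS, Or.inr rfl⟩
          · tauto
      rw [this, sum_insert (by simp)]
      have h2 : ∑ A ∈ F with A ⊂ S, ((#S).choose #A : ℝ)⁻¹ * g A ≤
          ∑ A ∈ F with A ⊂ S, ((#S).choose #A : ℝ)⁻¹ :=
        sum_le_sum fun A _ => mul_le_of_le_one_right (by positivity) (hg1 A)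
      simp only [Nat.choose_self, Nat.cast_one, inv_one, one_mul]
      have h3 : g S = 1 - ∑ A ∈ F with A ⊂ S, ((#S).choose #A : ℝ)⁻¹ := rfl
      linarith
    · have : {A ∈ F | A ⊆ S} = {A ∈ F | A ⊂ S} := by
        ext A
        simp only [mem_filter, ssubset_iff_subset_ne]
        exact ⟨fun h => ⟨h.1, h.2, fun e => hS (e ▸ h.1)⟩, fun h => ⟨h.1, h.2.1⟩⟩
      rw [this]
      rcases S.eq_empty_or_nonempty with rfl | hne
      · simp
      · rw [sum_ssubset_inv_choose F g S]
        have hle : ∑ x ∈ S, ∑ A ∈ F with A ⊆ S.erase x,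
            ((#(S.erase x)).choose #A : ℝ)⁻¹ * g A ≤ ∑ x ∈ S, 1 :=
          sum_le_sum fun x hx => ih _ (erase_ssubset hx)
        have hpos : (0 : ℝ) < #S := by exact_mod_cast hne.card_pos
        rw [inv_mul_le_iff₀ hpos]
        simpa using hle

open Finset in
/-- A family in which every member contains fewer than `d` others is hardly larger than the middle
layer. -/
theorem card_mul_le_choose_half {α : Type*} [DecidableEq α] [Fintype α] (F : Finset (Finset α))
    {d r : ℕ} (hr : 0 < r) (hdr : d ≤ r) (hF : ∀ A ∈ F, r ≤ #A)
    (hd : ∀ A ∈ F, #{C ∈ F | C ⊂ A} < d) :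
    (#F : ℝ) * (1 - d / r) ≤ (Fintype.card α).choose (Fintype.card α / 2) := by
  set n := Fintype.card α
  have hN : (0 : ℝ) < n.choose (n / 2) := by
    exact_mod_cast Nat.choose_pos (Nat.div_le_self _ _)
  have hr' : (0 : ℝ) < r := by exact_mod_cast hr
  have h := sum_inv_choose_mul_le_one F univ
  simp only [subset_univ, filter_true, card_univ] at h
  have hlow : ∀ A ∈ F, ((n.choose (n / 2) : ℝ))⁻¹ * (1 - d / r) ≤
      (n.choose #A : ℝ)⁻¹ * (1 - ∑ C ∈ F with C ⊂ A, ((#A).choose #C : ℝ)⁻¹) := by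
    intro A hA
    have hsum : ∑ C ∈ F with C ⊂ A, ((#A).choose #C : ℝ)⁻¹ ≤ d / r := by
      have : ∀ C ∈ ({C ∈ F | C ⊂ A} : Finset (Finset α)), ((#A).choose #C : ℝ)⁻¹ ≤ (r : ℝ)⁻¹ := by
        intro C hC
        obtain ⟨hCF, hCA⟩ := mem_filter.1 hC
        have h1 := card_lt_card hCA
        have h2 := hF C hCF
        have h3 : r ≤ (#A).choose #C := by
          have : (#C + 1).choose #C ≤ (#A).choose #C := Nat.choose_le_choose _ h1
          rw [Nat.choose_succ_self_right] at this
          omega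
        gcongr
      calc _ ≤ ∑ C ∈ F with C ⊂ A, (r : ℝ)⁻¹ := sum_le_sum this
        _ = (#{C ∈ F | C ⊂ A} : ℝ) * (r : ℝ)⁻¹ := by simp
        _ ≤ d * (r : ℝ)⁻¹ := by
          gcongr
          exact (hd A hA).le
        _ = d / r := (div_eq_mul_inv _ _).symm
    have hd1 : (0 : ℝ) ≤ 1 - d / r := by
      rw [sub_nonneg, div_le_one hr']; exact_mod_cast hdr
    have hA0 : (0 : ℝ) < n.choose #A := by
      exact_mod_cast Nat.choose_pos (card_le_univ A)
    gcongr
    exact_mod_cast Nat.choose_le_middle _ _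
  have h2 := (card_nsmul_le_sum F _ _ hlow).trans h
  rw [nsmul_eq_mul] at h2
  field_simp at h2 ⊢
  linarith

open Finset in
theorem card_isAntichain_le {α : Type*} [DecidableEq α] [Fintype α] {d r Z : ℕ} {β : ℝ}
    (hβ : 1 ≤ β) (hd : β ^ d + 1 ≤ β ^ (d + 1)) (hdr : d < r)
    (hZ : ((Fintype.card α).choose (Fintype.card α / 2) : ℝ) / (1 - d / r) < Z + 1) :
    (#{I : Finset (Finset α) | ∀ a ∈ I, ∀ b ∈ I, ¬ a ⊂ b} : ℝ) ≤
      2 ^ #{A : Finset α | #A < r} * (β ^ 2 ^ Fintype.card α * 2 ^ Z) := by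
  set W : Finset (Finset α) := {A | ¬ #A < r} with hW
  have hr : (0 : ℝ) < r := by exact_mod_cast (Nat.zero_le d).trans_lt hdr
  have hdr' : (0 : ℝ) < 1 - d / r := by
    rw [sub_pos, div_lt_one hr]; exact_mod_cast hdr
  have key := card_independent_le (fun a b : Finset α => a ⊂ b) (fun a => ssubset_irrefl a) d Z
    hβ hd W (by
      intro W' hW' hdeg
      have h1 := card_mul_le_choose_half W' ((Nat.zero_le d).trans_lt hdr) hdr.le
        (fun A hA => by simpa [hW] using hW' hA) hdeg
      rw [← le_div_iff₀ hdr'] at h1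
      have : (#W' : ℝ) < Z + 1 := h1.trans_lt hZ
      have : #W' < Z + 1 := by exact_mod_cast this
      omega)
  have hcard : #W ≤ 2 ^ Fintype.card α := by
    rw [← Fintype.card_finset]; exact card_le_univ W
  have hinj : #{I : Finset (Finset α) | ∀ a ∈ I, ∀ b ∈ I, ¬ a ⊂ b} ≤
      #(({A : Finset α | #A < r} : Finset (Finset α)).powerset ×ˢ
        {I ∈ W.powerset | ∀ a ∈ I, ∀ b ∈ I, ¬ a ⊂ b}) := by
    refine card_le_card_of_injOn
      (fun I => ({A ∈ I | #A < r}, {A ∈ I | ¬ #A < r})) ?_ ?_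
    · intro I hI
      simp only [coe_filter, mem_univ, true_and, Set.mem_ofPred_eq] at hI
      simp only [mem_coe, mem_product, mem_powerset, mem_filter, hW]
      exact ⟨filter_subset_filter _ (subset_univ _), filter_subset_filter _ (subset_univ _),
        fun a ha b hb => hI a ha.1 b hb.1⟩
    · intro I _ J _ h
      simp only [Prod.mk.injEq] at h
      rw [← filter_union_filter_not_eq (fun A : Finset α => #A < r) I, h.1, h.2,
        filter_union_filter_not_eq]
  rw [card_product, card_powerset] at hinj
  calc (#{I : Finset (Finset α) | ∀ a ∈ I, ∀ b ∈ I, ¬ a ⊂ b} : ℝ)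
      ≤ 2 ^ #{A : Finset α | #A < r} *
        (#{I ∈ W.powerset | ∀ a ∈ I, ∀ b ∈ I, ¬ a ⊂ b} : ℝ) := by exact_mod_cast hinj
    _ ≤ 2 ^ #{A : Finset α | #A < r} * (β ^ #W * 2 ^ Z) := by
        gcongr ?_ * ?_
        exact le_of_eq_of_le (by congr!) key
    _ ≤ _ := by gcongr

open Finset in
/-- Distinct up-closed families have distinct antichains of minimal members. -/
theorem card_le_card_isAntichain {α ι : Type*} [DecidableEq α] [Fintype α] [Fintype ι]
    (G : ι → Finset α → Prop) (hG : ∀ x A B, A ⊆ B → G x A → G x B)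
    (hinj : Function.Injective G) :
    Fintype.card ι ≤ #{I : Finset (Finset α) | ∀ a ∈ I, ∀ b ∈ I, ¬ a ⊂ b} := by
  classical
  rw [← card_univ]
  refine card_le_card_of_injOn (fun x => ({A | G x A ∧ ∀ B, B ⊂ A → ¬ G x B} : Finset (Finset α))) ?_ ?_
  · intro x _
    simp only [coe_filter, mem_univ, true_and, Set.mem_ofPred_eq, mem_filter]
    exact fun a ha b hb hab => hb.2 a hab ha.1
  · have hmin : ∀ x A, G x A ↔ ∃ B ⊆ A, G x B ∧ ∀ C, C ⊂ B → ¬ G x C := by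
      intro x A
      refine ⟨?_, fun ⟨B, hBA, hB, _⟩ => hG x B A hBA hB⟩
      induction A using Finset.strongInduction with
      | H A ih =>
        intro hA
        by_cases h : ∀ C, C ⊂ A → ¬ G x C
        · exact ⟨A, subset_rfl, hA, h⟩
        · push Not at h
          obtain ⟨C, hCA, hC⟩ := h
          obtain ⟨B, hBC, hB⟩ := ih C hCA hC
          exact ⟨B, hBC.trans hCA.subset, hB⟩
    intro x _ y _ hxy
    apply hinj
    ext A
    rw [hmin, hmin]
    have : ∀ B, (G x B ∧ ∀ C, C ⊂ B → ¬ G x C) ↔ (G y B ∧ ∀ C, C ⊂ B → ¬ G y C) := by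
      intro B
      simpa using Finset.ext_iff.1 hxy B
    simp only [this]

open Finset in
theorem IsOrientationCovering.card_le {n m : ℕ} {o : Fin (m + 1) → Fin n → Fin n → Prop}
    (h : IsOrientationCovering (⊤ : SimpleGraph (Fin n)) o) :
    n ≤ #{I : Finset (Finset (Fin m)) | ∀ a ∈ I, ∀ b ∈ I, ¬ a ⊂ b} := by
  classical
  obtain ⟨ho, hcov⟩ := h
  have hadj : ∀ {x y : Fin n}, x ≠ y → (⊤ : SimpleGraph (Fin n)).Adj x y :=
    fun h => (top_adj _ _).2 h
  have hflip : ∀ i {x y : Fin n}, x ≠ y → (o i x y ↔ ¬ o i y x) :=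
    fun i x y hxy => (ho i).2 x y (hadj hxy)
  let G : Fin n → Finset (Fin m) → Prop := fun x S =>
    ∃ y, y ≠ x ∧ ∀ i, o i x y → ∃ j ∈ S, i = j.castSucc
  have hne : ∀ x y, x ≠ y → ¬ o (Fin.last m) x y → G x ≠ G y := by
    intro x y hxy hlast hG
    have h1 : G x {j | o j.castSucc x y} := by
      refine ⟨y, hxy.symm, fun i hi => ?_⟩
      induction i using Fin.lastCases with
      | last => exact absurd hi hlast
      | cast j => exact ⟨j, by simpa using hi, rfl⟩
    rw [hG] at h1
    obtain ⟨z, hz, h2⟩ := h1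
    obtain ⟨i, hi1, hi2⟩ := hcov y x z (hadj hxy.symm) (hadj hz.symm)
    obtain ⟨j, hj, rfl⟩ := h2 i hi2
    exact (hflip _ hxy).1 (by simpa using hj) hi1
  have hinj : Function.Injective G := by
    intro x y hG
    by_contra hxy
    by_cases hl : o (Fin.last m) x y
    · exact hne y x (Ne.symm hxy) ((hflip _ hxy).1 hl) hG.symm
    · exact hne x y hxy hl hG
  simpa using card_le_card_isAntichain G
    (fun x A B hAB ⟨y, hy, h⟩ => ⟨y, hy, fun i hi =>
      let ⟨j, hj, e⟩ := h i hi
      ⟨j, hAB hj, e⟩⟩) hinj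

open Finset in
/-- Subsets of the layer of `⌊k / 2⌋`-sets through a fixed point yield orientation coverings. -/
theorem exists_isOrientationCovering_s13 {n m : ℕ} (hm : 0 < m)
    (h : n ≤ 2 ^ m.choose ((m + 1) / 2 - 1)) :
    ∃ o : Fin (m + 1) → Fin n → Fin n → Prop,
      IsOrientationCovering (⊤ : SimpleGraph (Fin n)) o := by
  classical
  set s := (m + 1) / 2 - 1 with hs
  -- index sets avoiding `0`
  let X : Finset (Finset (Fin m)) := univ.powersetCard s
  have hX : #X = m.choose s := by simp [X]
  obtain ⟨T, hTinj⟩ : ∃ T : Fin n → {T // T ∈ X.powerset}, Function.Injective T := by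
    have : Fintype.card (Fin n) ≤ Fintype.card {T // T ∈ X.powerset} := by
      rw [Fintype.card_coe, card_powerset, hX, Fintype.card_fin]; exact h
    exact (Function.Embedding.nonempty_of_card_le this).elim fun f => ⟨f, f.injective⟩
  -- a canonical separating set for each pair
  have hsep : ∀ x y, x ≠ y → ∃ A, A ∈ symmDiff (T x).1 (T y).1 := by
    intro x y hxy
    by_contra hA
    push Not at hA
    exact hxy (hTinj (Subtype.ext (symmDiff_eq_bot.1 (eq_empty_of_forall_notMem hA))))
  let P : Fin n → Fin n → Finset (Fin m) := fun x y =>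
    if h : (symmDiff (T x).1 (T y).1).Nonempty then h.choose else ∅
  have hPsymm : ∀ x y, P x y = P y x := by
    intro x y
    simp only [P, symmDiff_comm (T x).1 (T y).1]
  have hP : ∀ x y, x ≠ y → P x y ∈ symmDiff (T x).1 (T y).1 := by
    intro x y hxy
    have h : (symmDiff (T x).1 (T y).1).Nonempty := hsep x y hxy
    simp only [P, dif_pos h]
    exact h.choose_spec
  let Q : Finset (Fin m) → Finset (Fin (m + 1)) := fun A => insert 0 (A.map (Fin.succEmb m))
  have hQcard : ∀ A ∈ X, #(Q A) = (m + 1) / 2 := by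
    intro A hA
    have : #A = s := (mem_powersetCard.1 hA).2
    rw [card_insert_of_notMem (by simp [Fin.succ_ne_zero]), card_map, this]
    omega
  have hQinj : Function.Injective Q := by
    intro A B hAB
    have h1 : (0 : Fin (m + 1)) ∉ A.map (Fin.succEmb m) := by simp [Fin.succ_ne_zero]
    have h2 : (0 : Fin (m + 1)) ∉ B.map (Fin.succEmb m) := by simp [Fin.succ_ne_zero]
    have := congrArg (fun C => C.erase 0) hAB
    simp only [Q, erase_insert h1, erase_insert h2] at this
    exact map_injective _ this
  have hTX : ∀ {x A}, A ∈ (T x).1 → A ∈ X := fun {x A} hA => mem_powerset.1 (T x).2 hA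
  refine ⟨fun i x y => x ≠ y ∧ (i ∈ Q (P x y) ↔ P x y ∈ (T x).1), fun i => ⟨fun x y h => ?_,
    fun x y h => ?_⟩, fun x y z hxy hxz => ?_⟩
  · exact (top_adj _ _).2 h.1
  · have hxy := (top_adj _ _).1 h
    have := hP x y hxy
    rw [mem_symmDiff] at this
    beta_reduce
    rw [hPsymm y x]
    rcases this with ⟨h1, h2⟩ | ⟨h1, h2⟩ <;> simp [h1, h2, hxy, hxy.symm]
  · have hxy := (top_adj _ _).1 hxy
    have hxz := (top_adj _ _).1 hxz
    have hy := hP x y hxy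
    have hz := hP x z hxz
    have hyX : P x y ∈ X := by
      rcases mem_symmDiff.1 hy with h | h <;> exact hTX h.1
    have hzX : P x z ∈ X := by
      rcases mem_symmDiff.1 hz with h | h <;> exact hTX h.1
    have hyc := hQcard _ hyX
    have hzc := hQcard _ hzX
    have h0 : ∀ A, (0 : Fin (m + 1)) ∈ Q A := fun A => mem_insert_self _ _
    have hsub : ∀ {A B}, A ∈ X → B ∈ X → A ≠ B → ∃ i ∈ Q A, i ∉ Q B := by
      intro A B hA hB hAB
      by_contra hcon
      push Not at hcon
      exact hAB (hQinj (eq_of_subset_of_card_le hcon (by rw [hQcard A hA, hQcard B hB])))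
    by_cases hyT : P x y ∈ (T x).1 <;> by_cases hzT : P x z ∈ (T x).1
    · exact ⟨0, ⟨hxy, by simp [h0, hyT]⟩, hxz, by simp [h0, hzT]⟩
    · obtain ⟨i, hi1, hi2⟩ := hsub hyX hzX (fun e => hzT (e ▸ hyT))
      exact ⟨i, ⟨hxy, by simp [hi1, hyT]⟩, hxz, by simp [hi2, hzT]⟩
    · obtain ⟨i, hi1, hi2⟩ := hsub hzX hyX (fun e => hyT (e ▸ hzT))
      exact ⟨i, ⟨hxy, by simp [hi2, hyT]⟩, hxz, by simp [hi1, hzT]⟩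
    · obtain ⟨i, hi⟩ : ∃ i, i ∉ Q (P x y) ∪ Q (P x z) := by
        by_contra hcon
        push Not at hcon
        have huniv : Q (P x y) ∪ Q (P x z) = univ := eq_univ_of_forall hcon
        have h1 := card_union_add_card_inter (Q (P x y)) (Q (P x z))
        have h2 : 0 < #(Q (P x y) ∩ Q (P x z)) :=
          card_pos.2 ⟨0, mem_inter.2 ⟨h0 _, h0 _⟩⟩
        rw [huniv, card_univ, Fintype.card_fin] at h1
        omega
      rw [mem_union, not_or] at hi
      exact ⟨i, ⟨hxy, by simp [hi.1, hyT]⟩, hxz, by simp [hi.2, hzT]⟩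

section

open Filter Topology Real

theorem tendsto_sq_centralBinom_div :
    Tendsto (fun k : ℕ => ((k.centralBinom : ℝ) / 4 ^ k) ^ 2 * (2 * k + 1)) atTop (𝓝 (2 / π)) := by
  have h := Wallis.tendsto_W_nhds_pi_div_two.inv₀ (by positivity)
  rw [inv_div] at h
  refine h.congr fun k => ?_
  rw [Wallis.W_eq_factorial_ratio, Nat.centralBinom_eq_two_mul_choose,
    Nat.cast_choose ℝ (by omega : k ≤ 2 * k), show 2 * k - k = k by omega]
  have h4 : (2 : ℝ) ^ (4 * k) = (4 ^ k) ^ 2 := by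
    rw [show (4 : ℝ) = 2 ^ 2 by norm_num, ← pow_mul, ← pow_mul]
    congr 1
    ring
  rw [h4]
  have := Nat.factorial_pos k
  have := Nat.factorial_pos (2 * k)
  field_simp

theorem choose_half_div_two_pow (m : ℕ) :
    (m.choose (m / 2) : ℝ) / 2 ^ m = (((m + 1) / 2).centralBinom : ℝ) / 4 ^ ((m + 1) / 2) := by
  obtain ⟨k, rfl | rfl⟩ := Nat.even_or_odd' m
  · rw [show 2 * k / 2 = k by omega, show (2 * k + 1) / 2 = k by omega, pow_mul,
      Nat.centralBinom_eq_two_mul_choose]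
    norm_num
  · rw [show (2 * k + 1) / 2 = k by omega, show (2 * k + 1 + 1) / 2 = k + 1 by omega,
      Nat.centralBinom_eq_two_mul_choose, show 2 * (k + 1) = 2 * k + 1 + 1 by ring,
      Nat.choose_succ_succ, ← Nat.choose_symm_half k, pow_succ, pow_succ, pow_mul]
    push_cast
    norm_num
    ring

theorem tendsto_choose_half :
    Tendsto (fun m : ℕ => (m.choose (m / 2) : ℝ) * √m / 2 ^ m) atTop (𝓝 √(2 / π)) := by
  have hk : Tendsto (fun m : ℕ => (m + 1) / 2) atTop atTop :=
    tendsto_atTop_mono (fun m => by omega) (Nat.tendsto_div_const_atTop (n := 2) (by norm_num))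
  have h1 := tendsto_sq_centralBinom_div.comp hk
  have h2 : Tendsto (fun m : ℕ => (m : ℝ) / (2 * ((m + 1) / 2 : ℕ) + 1)) atTop (𝓝 1) := by
    have hl : Tendsto (fun m : ℕ => (m : ℝ) / (m + 2)) atTop (𝓝 1) :=
      tendsto_natCast_div_add_atTop (2 : ℝ)
    refine tendsto_of_tendsto_of_tendsto_of_le_of_le hl tendsto_const_nhds (fun m => ?_)
      (fun m => ?_)
    · have : 2 * ((m + 1) / 2 : ℕ) ≤ m + 1 := by omega
      have : (2 * ((m + 1) / 2 : ℕ) : ℝ) ≤ m + 1 := by exact_mod_cast this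
      dsimp only
      exact div_le_div_of_nonneg_left (by positivity) (by positivity) (by linarith)
    · have : m ≤ 2 * ((m + 1) / 2 : ℕ) := by omega
      have : (m : ℝ) ≤ 2 * ((m + 1) / 2 : ℕ) := by exact_mod_cast this
      dsimp only
      rw [div_le_one (by positivity)]
      linarith
  have h3 := ((h1.mul h2).sqrt)
  rw [mul_one] at h3
  refine h3.congr fun m => ?_
  simp only [Function.comp_apply]
  rw [← choose_half_div_two_pow]
  have : (0 : ℝ) < 2 * ((m + 1) / 2 : ℕ) + 1 := by positivity
  rw [mul_assoc, mul_div_cancel₀ _ this.ne', Real.sqrt_mul (by positivity),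
    Real.sqrt_sq (by positivity)]
  ring

open Finset in
theorem card_card_le_quarter_le (m : ℕ) :
    (#{A : Finset (Fin m) | #A < m / 4 + 1} : ℝ) ≤ (3 / 2 * 2 ^ (1 / 4 : ℝ)) ^ m := by
  have h := Fintype.sum_pow_mul_eq_add_pow (Fin m) (1 / 2 : ℝ) 1
  simp only [one_pow, mul_one, Fintype.card_fin] at h
  have h1 : (#{A : Finset (Fin m) | #A < m / 4 + 1} : ℝ) * (2 ^ (1 / 4 : ℝ) : ℝ)⁻¹ ^ m ≤
      ∑ A : Finset (Fin m), (1 / 2 : ℝ) ^ #A := by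
    rw [← nsmul_eq_mul]
    refine (card_nsmul_le_sum _ (fun A : Finset (Fin m) => (1 / 2 : ℝ) ^ #A) _ ?_).trans
      (sum_le_sum_of_subset_of_nonneg (subset_univ _) fun _ _ _ => by positivity)
    intro A hA
    have hA' : #A * 4 ≤ m := by
      have := (mem_filter.1 hA).2
      omega
    have hq : ((2 ^ (1 / 4 : ℝ) : ℝ)⁻¹) ^ 4 = 1 / 2 := by
      rw [inv_pow, ← Real.rpow_natCast, ← Real.rpow_mul (by norm_num)]
      norm_num
    have hle : (2 ^ (1 / 4 : ℝ) : ℝ)⁻¹ ≤ 1 :=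
      inv_le_one_of_one_le₀ (Real.one_le_rpow (by norm_num) (by norm_num))
    calc ((2 ^ (1 / 4 : ℝ) : ℝ)⁻¹) ^ m ≤ ((2 ^ (1 / 4 : ℝ) : ℝ)⁻¹) ^ (4 * #A) :=
          pow_le_pow_of_le_one (by positivity) hle (by omega)
      _ = (1 / 2) ^ #A := by rw [pow_mul, hq]
  rw [h, inv_pow, ← div_eq_mul_inv, div_le_iff₀ (by positivity)] at h1
  refine h1.trans_eq ?_
  rw [mul_pow]
  norm_num

/-- If `a k` is asymptotic to `2 ^ k / √(2πk)`, then its binary logarithm plus half of its iterated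
binary logarithm is `k - (log₂ π + 1) / 2 + o(1)`. -/
theorem tendsto_logb_add_logb_logb {a : ℕ → ℝ}
    (ha : Tendsto (fun k : ℕ => a k * √k / 2 ^ k) atTop (𝓝 √(1 / (2 * π)))) :
    Tendsto (fun k : ℕ => logb 2 (a k) + 1 / 2 * logb 2 (logb 2 (a k)) +
      1 / 2 * (logb 2 π + 1) - k) atTop (𝓝 0) := by
  have hc : (0 : ℝ) < √(1 / (2 * π)) := by positivity
  have hpos : ∀ᶠ k : ℕ in atTop, 0 < a k ∧ 0 < k := by
    filter_upwards [ha.eventually_const_lt hc, eventually_gt_atTop 0] with k hk hk0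
    have hk0' : (0 : ℝ) < k := by exact_mod_cast hk0
    refine ⟨?_, hk0⟩
    by_contra! hcon
    have : a k * √k / 2 ^ k ≤ 0 :=
      div_nonpos_of_nonpos_of_nonneg (mul_nonpos_of_nonpos_of_nonneg hcon (by positivity))
        (by positivity)
    linarith
  have h1 : Tendsto (fun k : ℕ => logb 2 (a k) + 1 / 2 * logb 2 k - k) atTop
      (𝓝 (-(1 / 2 * (logb 2 π + 1)))) := by
    have hl : Tendsto (fun k : ℕ => logb 2 (a k * √k / 2 ^ k)) atTop
        (𝓝 (logb 2 √(1 / (2 * π)))) :=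
      (Real.continuousAt_logb hc.ne').tendsto.comp ha
    have he : logb 2 √(1 / (2 * π)) = -(1 / 2 * (logb 2 π + 1)) := by
      rw [Real.sqrt_eq_rpow, Real.logb_rpow_eq_mul_logb_of_pos (by positivity), one_div (2 * π),
        Real.logb_inv, Real.logb_mul (by norm_num) (by positivity),
        Real.logb_self_eq_one (by norm_num)]
      ring
    rw [he] at hl
    refine hl.congr' ?_
    filter_upwards [hpos] with k ⟨hk, hk0⟩
    have hk0' : (0 : ℝ) < k := by exact_mod_cast hk0
    rw [Real.logb_div (by positivity) (by positivity), Real.logb_mul hk.ne' (by positivity),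
      Real.sqrt_eq_rpow, Real.logb_rpow_eq_mul_logb_of_pos hk0', Real.logb_pow,
      Real.logb_self_eq_one (by norm_num), mul_one]
  have hlogk : Tendsto (fun k : ℕ => logb 2 (k : ℝ) / k) atTop (𝓝 0) := by
    have : Tendsto (fun x : ℝ => log x / x) atTop (𝓝 0) :=
      Real.isLittleO_log_id_atTop.tendsto_div_nhds_zero
    have := (this.comp tendsto_natCast_atTop_atTop).div_const (log 2)
    rw [zero_div] at this
    refine this.congr fun k => ?_
    simp only [Function.comp_apply, logb]
    ring
  have h2 : Tendsto (fun k : ℕ => logb 2 (a k) / k) atTop (𝓝 1) := by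
    have hinv : Tendsto (fun k : ℕ => ((k : ℝ))⁻¹) atTop (𝓝 0) :=
      tendsto_inv_atTop_zero.comp tendsto_natCast_atTop_atTop
    have := ((h1.mul hinv).sub (hlogk.const_mul (1 / 2))).add_const 1
    simp only [mul_zero, sub_zero, zero_add] at this
    refine this.congr' ?_
    filter_upwards [eventually_gt_atTop 0] with k hk
    have : (0 : ℝ) < k := by exact_mod_cast hk
    field_simp
    ring
  have h3 : Tendsto (fun k : ℕ => logb 2 (logb 2 (a k)) - logb 2 k) atTop (𝓝 0) := by
    have := (Real.continuousAt_logb (b := 2) one_ne_zero).tendsto.comp h2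
    rw [Real.logb_one] at this
    refine this.congr' ?_
    filter_upwards [h2.eventually_const_lt (zero_lt_one), eventually_gt_atTop 0] with k hk hk0
    have hk0' : (0 : ℝ) < k := by exact_mod_cast hk0
    have : 0 < logb 2 (a k) := by
      have := mul_pos hk hk0'
      rwa [div_mul_cancel₀ _ hk0'.ne'] at this
    exact Real.logb_div this.ne' hk0'.ne'
  have := (h1.add (h3.const_mul (1 / 2))).add_const (1 / 2 * (logb 2 π + 1))
  simp only [mul_zero, add_zero, neg_add_cancel] at this
  refine this.congr fun k => ?_
  ring

/-- A real sequence lying within `o(1)` of the interval `(σ n - 1, σ n]` can be perturbed by `o(1)`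
so that its ceiling is `σ n`. -/
theorem exists_tendsto_zero_eq_ceil {h : ℕ → ℝ} {σ : ℕ → ℕ} {a b : ℕ → ℝ}
    (hσ : Tendsto σ atTop atTop) (ha : Tendsto a atTop (𝓝 0)) (hb : Tendsto b atTop (𝓝 0))
    (hup : ∀ᶠ n in atTop, h n ≤ σ n + a (σ n)) (hlo : ∀ᶠ n in atTop, σ n - 1 + b (σ n) ≤ h n) :
    ∃ e : ℕ → ℝ, Tendsto e atTop (𝓝 0) ∧ ∀ᶠ n in atTop, (σ n : ℤ) = ⌈h n + e n⌉ := by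
  have hinv : Tendsto (fun k : ℕ => 1 / ((k : ℝ) + 1)) atTop (𝓝 0) :=
    tendsto_one_div_add_atTop_nhds_zero_nat
  refine ⟨fun n => max (min (h n) (σ n)) (σ n - 1 + 1 / ((σ n : ℝ) + 1)) - h n, ?_,
    Eventually.of_forall fun n => ?_⟩
  · have hbound : Tendsto (fun k => |a k| + |b k| + 1 / ((k : ℝ) + 1)) atTop (𝓝 0) := by
      simpa using (ha.abs.add hb.abs).add hinv
    refine squeeze_zero_norm' ?_ (hbound.comp hσ)
    filter_upwards [hup, hlo] with n h1 h2
    simp only [Function.comp_apply, Real.norm_eq_abs]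
    have ha1 := le_abs_self (a (σ n))
    have hb1 := neg_abs_le (b (σ n))
    have ha0 := abs_nonneg (a (σ n))
    have hb0 := abs_nonneg (b (σ n))
    have hp : 0 < 1 / ((σ n : ℝ) + 1) := by positivity
    rw [abs_le]
    constructor
    · rw [neg_le_sub_iff_le_add, ← sub_le_iff_le_add]
      refine le_trans ?_ (le_max_left _ _)
      exact le_min (by linarith) (by linarith)
    · rw [sub_le_iff_le_add]
      refine max_le ((min_le_left _ _).trans (by linarith)) (by linarith)
  · symm
    rw [Int.ceil_eq_iff, add_sub_cancel]
    have hp : 0 < 1 / ((σ n : ℝ) + 1) := by positivity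
    have hp1 : 1 / ((σ n : ℝ) + 1) ≤ 1 := by
      rw [div_le_one (by positivity)]; linarith [Nat.cast_nonneg (α := ℝ) (σ n)]
    push_cast
    constructor
    · exact lt_of_lt_of_le (by linarith) (le_max_right _ _)
    · exact max_le (min_le_right _ _) (by linarith)

theorem tendsto_card_small_div_choose_half :
    Tendsto (fun m : ℕ => (Finset.card {A : Finset (Fin m) | A.card < m / 4 + 1} : ℝ) /
      m.choose (m / 2)) atTop (𝓝 0) := by
  have hq : ((2 : ℝ) ^ (1 / 4 : ℝ)) ^ 4 = 2 := by
    rw [← Real.rpow_natCast, ← Real.rpow_mul (by norm_num)]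
    norm_num
  have hq0 : (0 : ℝ) < 2 ^ (1 / 4 : ℝ) := by positivity
  set q : ℝ := 2 ^ (1 / 4 : ℝ) with hqdef
  have hρ : 3 / 4 * q < 1 := by
    by_contra! hcon
    have : (4 / 3 : ℝ) ^ 4 ≤ q ^ 4 := by gcongr; linarith
    rw [hq] at this
    norm_num at this
  have h1 := tendsto_self_mul_const_pow_of_lt_one (by positivity : 0 ≤ 3 / 4 * q) hρ
  have h2 := h1.mul (tendsto_choose_half.inv₀ (by positivity))
  rw [zero_mul] at h2
  refine squeeze_zero' (Eventually.of_forall fun m => by positivity) ?_ h2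
  filter_upwards [eventually_gt_atTop 0] with m hm
  have hm' : (1 : ℝ) ≤ m := by exact_mod_cast hm
  have hN : (0 : ℝ) < m.choose (m / 2) := by
    exact_mod_cast Nat.choose_pos (Nat.div_le_self _ _)
  have hs := card_card_le_quarter_le m
  rw [← hqdef] at hs
  have hsqrt : √(m : ℝ) ≤ m := by
    rw [Real.sqrt_le_left (by positivity)]
    nlinarith
  have hsq0 : 0 < √(m : ℝ) := by positivity
  calc _ ≤ (3 / 2 * q) ^ m / m.choose (m / 2) := by gcongr
    _ = √m * (3 / 4 * q) ^ m * ((m.choose (m / 2) : ℝ) * √m / 2 ^ m)⁻¹ := by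
      rw [show 3 / 2 * q = 3 / 4 * q * 2 by ring, mul_pow _ (2 : ℝ)]
      field_simp
    _ ≤ _ := by gcongr

open Finset in
/-- The number of antichains in the Boolean lattice on `m` points is `2 ^ ((1 + o(1)) N)`, where `N`
is the size of the middle layer. -/
theorem exists_logb_card_isAntichain_le :
    ∃ u : ℕ → ℝ, Tendsto (fun m : ℕ => u m / m.choose (m / 2)) atTop (𝓝 1) ∧
      ∀ᶠ m in atTop, logb 2 #{I : Finset (Finset (Fin m)) | ∀ a ∈ I, ∀ b ∈ I, ¬ a ⊂ b} ≤ u m := by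
  set y : ℕ → ℝ := fun m => (m : ℝ) ^ (1 / 5 : ℝ) with hy
  have hy5 : ∀ m, y m ^ 5 = m := fun m => by
    simp only [hy]
    rw [← Real.rpow_natCast, ← Real.rpow_mul (by positivity)]
    norm_num
  have hyt : Tendsto y atTop atTop :=
    (tendsto_rpow_atTop (by norm_num)).comp tendsto_natCast_atTop_atTop
  have hyinv : Tendsto (fun m => (y m)⁻¹) atTop (𝓝 0) := tendsto_inv_atTop_zero.comp hyt
  set d : ℕ → ℕ := fun m => ⌈y m ^ 4⌉₊ with hddef
  have hdr : Tendsto (fun m : ℕ => (d m : ℝ) / (m / 4 + 1 : ℕ)) atTop (𝓝 0) := by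
    have h8 := hyinv.const_mul 8
    rw [mul_zero] at h8
    refine squeeze_zero' (Eventually.of_forall fun m => by positivity) ?_ h8
    filter_upwards [hyt.eventually_ge_atTop 1] with m hm
    have h1 : (d m : ℝ) ≤ 2 * y m ^ 4 := by
      have := Nat.ceil_lt_add_one (by positivity : 0 ≤ y m ^ 4)
      have := one_le_pow₀ hm (n := 4)
      simp only [hddef]
      linarith
    have h2 : y m ^ 5 / 4 ≤ (m / 4 + 1 : ℕ) := by
      rw [hy5, div_le_iff₀ (by norm_num)]
      have : m ≤ (m / 4 + 1) * 4 := by omega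
      exact_mod_cast this
    have hy0 : 0 < y m := by linarith
    calc (d m : ℝ) / (m / 4 + 1 : ℕ) ≤ 2 * y m ^ 4 / (y m ^ 5 / 4) := by gcongr
      _ = 8 * (y m)⁻¹ := by field_simp; norm_num
  have hsub : Tendsto (fun m : ℕ => 1 - (d m : ℝ) / (m / 4 + 1 : ℕ)) atTop (𝓝 1) := by
    simpa using hdr.const_sub 1
  set β : ℕ → ℝ := fun m => 1 + (y m ^ 3)⁻¹ with hβdef
  refine ⟨fun m => #{A : Finset (Fin m) | #A < m / 4 + 1} + 2 ^ m * logb 2 (β m) +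
    m.choose (m / 2) / (1 - d m / (m / 4 + 1 : ℕ)), ?_, ?_⟩
  · have h2 : Tendsto (fun m : ℕ => 2 ^ m * logb 2 (β m) / m.choose (m / 2)) atTop (𝓝 0) := by
      have hs : Tendsto (fun m => (√(y m))⁻¹) atTop (𝓝 0) :=
        tendsto_inv_atTop_zero.comp (Real.tendsto_sqrt_atTop.comp hyt)
      have := ((hs.div_const (log 2)).mul (tendsto_choose_half.inv₀ (by positivity)))
      rw [zero_div, zero_mul] at this
      refine squeeze_zero' ?_ ?_ this
      · filter_upwards with m
        have : 0 ≤ y m := by positivity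
        have : 0 ≤ logb 2 (β m) := Real.logb_nonneg (by norm_num) (by simp [hβdef]; positivity)
        positivity
      · filter_upwards [hyt.eventually_ge_atTop 1] with m hm
        have hy0 : 0 < y m := by linarith
        have hN : (0 : ℝ) < m.choose (m / 2) := by
          exact_mod_cast Nat.choose_pos (Nat.div_le_self _ _)
        have hlog : logb 2 (β m) ≤ (y m ^ 3)⁻¹ / log 2 := by
          have hl2 : 0 < log 2 := Real.log_pos (by norm_num)
          have := Real.log_le_sub_one_of_pos (by positivity : 0 < β m)
          rw [logb]
          gcongr
          simpa [hβdef] using this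
        have hsm : √(m : ℝ) = y m ^ 2 * √(y m) := by
          rw [← hy5, show y m ^ 5 = (y m ^ 2) ^ 2 * y m by ring, Real.sqrt_mul (by positivity),
            Real.sqrt_sq (by positivity)]
        have hsy : √(y m) * √(y m) = y m := Real.mul_self_sqrt hy0.le
        have hsy0 : 0 < √(y m) := by positivity
        calc 2 ^ m * logb 2 (β m) / m.choose (m / 2)
            ≤ 2 ^ m * ((y m ^ 3)⁻¹ / log 2) / m.choose (m / 2) := by gcongr
          _ = (√(y m))⁻¹ / log 2 * ((m.choose (m / 2) : ℝ) * √m / 2 ^ m)⁻¹ := by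
            rw [hsm]
            have hl2 : log 2 ≠ 0 := (Real.log_pos (by norm_num)).ne'
            field_simp
            rw [Real.sq_sqrt hy0.le]
    have := (tendsto_card_small_div_choose_half.add h2).add (hsub.inv₀ one_ne_zero)
    rw [add_zero, zero_add, inv_one] at this
    refine this.congr fun m => ?_
    have hN : (m.choose (m / 2) : ℝ) ≠ 0 := by
      exact_mod_cast (Nat.choose_pos (Nat.div_le_self _ _)).ne'
    rw [add_div, add_div, div_right_comm _ _ (m.choose (m / 2) : ℝ), div_self hN, one_div]
  · have hexp : ∀ᶠ m in atTop, y m ^ 3 ≤ exp (1 / 2 * y m) := by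
      have := hyt.eventually ((isLittleO_pow_exp_pos_mul_atTop 3 (by norm_num : (0 : ℝ) < 1 / 2)).bound
        (by norm_num : (0 : ℝ) < 1))
      filter_upwards [this] with m hm
      rw [one_mul, Real.norm_eq_abs, Real.norm_eq_abs, abs_of_pos (Real.exp_pos _)] at hm
      exact (le_abs_self _).trans hm
    filter_upwards [hexp, hyt.eventually_ge_atTop 1,
      hdr.eventually_lt_const (zero_lt_one)] with m he hm hlt
    have hy0 : 0 < y m := by linarith
    have hx0 : 0 < (y m ^ 3)⁻¹ := by positivity
    have hx1 : (y m ^ 3)⁻¹ ≤ 1 := inv_le_one_of_one_le₀ (one_le_pow₀ hm)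
    have hβ1 : 1 ≤ β m := by simp only [hβdef]; linarith
    have hβ0 : 0 < β m := by linarith
    have hpow : y m ^ 3 ≤ β m ^ d m := by
      have hlog : (y m ^ 3)⁻¹ / 2 ≤ log (β m) := by
        refine le_trans ?_ (Real.one_sub_inv_le_log_of_pos hβ0)
        have : 1 - (β m)⁻¹ = (y m ^ 3)⁻¹ / β m := by
          field_simp
          simp only [hβdef, add_sub_cancel_left]
          field_simp
        rw [this]
        gcongr
        simp only [hβdef]
        linarith
      have hd4 : y m ^ 4 ≤ d m := Nat.le_ceil _
      calc y m ^ 3 ≤ exp (1 / 2 * y m) := he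
        _ = exp (y m ^ 4 * ((y m ^ 3)⁻¹ / 2)) := by congr 1; field_simp
        _ ≤ exp (d m * log (β m)) := by gcongr
        _ = β m ^ d m := by rw [Real.exp_nat_mul, Real.exp_log hβ0]
    have hd : β m ^ d m + 1 ≤ β m ^ (d m + 1) := by
      have : 1 ≤ β m ^ d m * (y m ^ 3)⁻¹ := by
        rw [← div_eq_mul_inv, one_le_div (by positivity)]; exact hpow
      rw [pow_succ]
      conv_rhs => rw [show β m ^ d m * β m = β m ^ d m + β m ^ d m * (y m ^ 3)⁻¹ by
        simp only [hβdef]; ring]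
      linarith
    have hlt' : d m < m / 4 + 1 := by
      rw [div_lt_one (by positivity)] at hlt
      exact_mod_cast hlt
    set Z := ⌊(m.choose (m / 2) : ℝ) / (1 - d m / (m / 4 + 1 : ℕ))⌋₊ with hZ
    have hmain := card_isAntichain_le (α := Fin m) (Z := Z) hβ1 hd hlt' (by
      rw [Fintype.card_fin]; exact Nat.lt_floor_add_one _)
    rw [Fintype.card_fin] at hmain
    have hpos : (0 : ℝ) < #{I : Finset (Finset (Fin m)) | ∀ a ∈ I, ∀ b ∈ I, ¬ a ⊂ b} := by
      have : 0 < #{I : Finset (Finset (Fin m)) | ∀ a ∈ I, ∀ b ∈ I, ¬ a ⊂ b} :=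
        card_pos.2 ⟨∅, by simp⟩
      exact_mod_cast this
    have hZle : (Z : ℝ) ≤ (m.choose (m / 2) : ℝ) / (1 - d m / (m / 4 + 1 : ℕ)) :=
      Nat.floor_le (div_nonneg (by positivity) (by linarith))
    refine (Real.logb_le_logb_of_le (by norm_num) hpos hmain).trans ?_
    rw [Real.logb_mul (by positivity) (by positivity), Real.logb_mul (by positivity) (by positivity),
      Real.logb_pow, Real.logb_pow, Real.logb_pow, Real.logb_self_eq_one (by norm_num)]
    push_cast at hZle ⊢
    linarith

theorem tendsto_of_tendsto_div_choose_half {v : ℕ → ℝ}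
    (hv : Tendsto (fun m : ℕ => v m / m.choose (m / 2)) atTop (𝓝 1)) :
    Tendsto (fun k : ℕ => v (k - 1) * √k / 2 ^ k) atTop (𝓝 √(1 / (2 * π))) := by
  rw [← tendsto_add_atTop_iff_nat 1]
  have h1 : Tendsto (fun m : ℕ => √((m : ℝ) / (m + 1))) atTop (𝓝 1) := by
    simpa using (tendsto_natCast_div_add_atTop (1 : ℝ)).sqrt
  have h := (((hv.mul tendsto_choose_half).mul (h1.inv₀ one_ne_zero)).div_const 2)
  have hc : 1 * √(2 / π) * 1⁻¹ / 2 = √(1 / (2 * π)) := by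
    rw [eq_comm, Real.sqrt_eq_iff_mul_self_eq (by positivity) (by positivity)]
    have := Real.mul_self_sqrt (by positivity : 0 ≤ 2 / π)
    field_simp at this ⊢
    linarith
  rw [hc] at h
  refine h.congr' ?_
  filter_upwards [eventually_gt_atTop 0] with m hm
  have hm' : (0 : ℝ) < m := by exact_mod_cast hm
  have hN : (m.choose (m / 2) : ℝ) ≠ 0 := by
    exact_mod_cast (Nat.choose_pos (Nat.div_le_self _ _)).ne'
  rw [Real.sqrt_div (by positivity), Nat.add_sub_cancel, pow_succ]
  push_cast
  have : √(m : ℝ) ≠ 0 := by positivity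
  field_simp

theorem half_le_choose {m : ℕ} (hm : 0 < m) : (m + 1) / 2 ≤ m.choose ((m + 1) / 2 - 1) := by
  obtain ⟨k, hk⟩ : ∃ k, (m + 1) / 2 = k + 1 := ⟨(m + 1) / 2 - 1, by omega⟩
  rw [hk, Nat.add_sub_cancel]
  calc k + 1 = (k + 1).choose k := (Nat.choose_succ_self_right k).symm
    _ ≤ m.choose k := Nat.choose_le_choose _ (by omega)

theorem tendsto_choose_div_choose_half :
    Tendsto (fun m : ℕ => (m.choose ((m + 1) / 2 - 1) : ℝ) / m.choose (m / 2)) atTop (𝓝 1) := by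
  refine tendsto_of_tendsto_of_tendsto_of_le_of_le (tendsto_natCast_div_add_atTop (2 : ℝ))
    tendsto_const_nhds (fun m => ?_) (fun m => ?_)
  all_goals
    have hN : (0 : ℝ) < m.choose (m / 2) := by
      exact_mod_cast Nat.choose_pos (Nat.div_le_self _ _)
    dsimp only
  · rw [div_le_div_iff₀ (by positivity) hN]
    have : m * m.choose (m / 2) ≤ m.choose ((m + 1) / 2 - 1) * (m + 2) := by
      obtain ⟨j, rfl | rfl⟩ := Nat.even_or_odd' m
      · rcases j with _ | j
        · simp
        · have := Nat.choose_succ_right_eq (2 * (j + 1)) j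
          rw [show 2 * (j + 1) - j = j + 2 by omega] at this
          rw [show (2 * (j + 1) + 1) / 2 - 1 = j by omega, show 2 * (j + 1) / 2 = j + 1 by omega]
          nlinarith
      · rw [show (2 * j + 1 + 1) / 2 - 1 = j by omega, show (2 * j + 1) / 2 = j by omega]
        nlinarith
    exact_mod_cast this
  · rw [div_le_one hN]
    exact_mod_cast Nat.choose_le_middle _ _

open Finset in
theorem orCov_completeGraph_spec (n : ℕ) :
    0 < orCov (⊤ : SimpleGraph (Fin n)) ∧
      ∃ o : Fin (orCov (⊤ : SimpleGraph (Fin n))) → Fin n → Fin n → Prop,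
        IsOrientationCovering (⊤ : SimpleGraph (Fin n)) o := by
  have hn : n ≤ 2 ^ (2 * n + 1).choose ((2 * n + 1 + 1) / 2 - 1) := by
    have h := half_le_choose (m := 2 * n + 1) (by omega)
    exact Nat.lt_two_pow_self.le.trans (Nat.pow_le_pow_right (by norm_num) (by omega))
  exact Nat.sInf_mem (s := {k | 0 < k ∧ ∃ o : Fin k → Fin n → Fin n → Prop,
    IsOrientationCovering (⊤ : SimpleGraph (Fin n)) o})
    ⟨_, Nat.succ_pos _, exists_isOrientationCovering_s13 (by omega) hn⟩

open Finset in
theorem le_card_isAntichain_of_orCov_eq {n m : ℕ} (h : orCov (⊤ : SimpleGraph (Fin n)) = m + 1) :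
    n ≤ #{I : Finset (Finset (Fin m)) | ∀ a ∈ I, ∀ b ∈ I, ¬ a ⊂ b} := by
  have ho := (orCov_completeGraph_spec n).2
  rw [h] at ho
  obtain ⟨o, ho⟩ := ho
  exact ho.card_le

theorem two_pow_choose_lt_of_lt_orCov {n m : ℕ} (hm : 0 < m)
    (h : m + 1 < orCov (⊤ : SimpleGraph (Fin n))) :
    2 ^ m.choose ((m + 1) / 2 - 1) < n := by
  by_contra! hn
  exact Nat.notMem_of_lt_sInf h ⟨Nat.succ_pos _, exists_isOrientationCovering_s13 hm hn⟩

open Finset in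
theorem tendsto_orCov_completeGraph :
    Tendsto (fun n : ℕ => orCov (⊤ : SimpleGraph (Fin n))) atTop atTop := by
  refine tendsto_atTop.2 fun K => ?_
  filter_upwards [eventually_gt_atTop (∑ m ∈ range K,
    #{I : Finset (Finset (Fin m)) | ∀ a ∈ I, ∀ b ∈ I, ¬ a ⊂ b})] with n hn
  by_contra! hK
  obtain ⟨m, hm⟩ := Nat.exists_eq_succ_of_ne_zero (orCov_completeGraph_spec n).1.ne'
  have h1 := le_card_isAntichain_of_orCov_eq hm
  have h2 := single_le_sum (s := range K)
    (f := fun m => #{I : Finset (Finset (Fin m)) | ∀ a ∈ I, ∀ b ∈ I, ¬ a ⊂ b})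
    (fun _ _ => Nat.zero_le _) (mem_range.2 (by omega : m < K))
  omega

theorem logb_add_logb_logb_le {y z : ℝ} (hy : 1 < y) (hyz : y ≤ z) :
    logb 2 y + 1 / 2 * logb 2 (logb 2 y) ≤ logb 2 z + 1 / 2 * logb 2 (logb 2 z) := by
  have h1 : 0 < logb 2 y := Real.logb_pos (by norm_num) hy
  have h2 : logb 2 y ≤ logb 2 z := Real.logb_le_logb_of_le (by norm_num) (by linarith) hyz
  have h3 : logb 2 (logb 2 y) ≤ logb 2 (logb 2 z) := Real.logb_le_logb_of_le (by norm_num) h1 h2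
  linarith

end

/-- `σ(K_n) = ⌈log₂ log₂ n + ½ log₂ log₂ log₂ n + ½ (log₂ π + 1) + o(1)⌉` as `n → ∞`. -/
theorem orCov_completeGraph_asymptotic :
    ∃ e : ℕ → ℝ, Filter.Tendsto e Filter.atTop (nhds 0) ∧
      ∀ᶠ n : ℕ in Filter.atTop,
        (orCov (⊤ : SimpleGraph (Fin n)) : ℤ) =
          ⌈Real.logb 2 (Real.logb 2 n) +
            (1 / 2) * Real.logb 2 (Real.logb 2 (Real.logb 2 n)) +
            (1 / 2) * (Real.logb 2 Real.pi + 1) + e n⌉ := by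
  obtain ⟨u, hu, hule⟩ := exists_logb_card_isAntichain_le
  have ha := tendsto_logb_add_logb_logb (tendsto_of_tendsto_div_choose_half hu)
  have hb := (tendsto_logb_add_logb_logb (tendsto_of_tendsto_div_choose_half
    tendsto_choose_div_choose_half)).comp (Filter.tendsto_sub_atTop_nat 1)
  have hσ := tendsto_orCov_completeGraph
  refine exists_tendsto_zero_eq_ceil hσ ha hb ?_ ?_
  · filter_upwards [((Filter.tendsto_sub_atTop_nat 1).comp hσ).eventually hule,
      Filter.eventually_gt_atTop 2] with n hn h2
    obtain ⟨m, hm'⟩ : ∃ m, orCov (⊤ : SimpleGraph (Fin n)) - 1 = m := ⟨_, rfl⟩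
    have hm : orCov (⊤ : SimpleGraph (Fin n)) = m + 1 := by
      have := (orCov_completeGraph_spec n).1
      omega
    have h1 := le_card_isAntichain_of_orCov_eq hm
    rw [Function.comp_apply, hm'] at hn
    rw [hm, Nat.add_sub_cancel]
    have h2' : (2 : ℝ) < n := by exact_mod_cast h2
    have hlog : 1 < Real.logb 2 n := by
      rw [Real.lt_logb_iff_rpow_lt (by norm_num) (by linarith)]
      simpa using h2'
    have hle : Real.logb 2 n ≤ u m :=
      (Real.logb_le_logb_of_le (by norm_num) (by linarith) (by exact_mod_cast h1)).trans hn
    have := logb_add_logb_logb_le hlog hle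
    linarith
  · filter_upwards [hσ.eventually_ge_atTop 5] with n hn
    obtain ⟨m, hm⟩ : ∃ m, orCov (⊤ : SimpleGraph (Fin n)) = m + 2 :=
      ⟨orCov (⊤ : SimpleGraph (Fin n)) - 2, by omega⟩
    rw [hm] at hn
    have h1 := two_pow_choose_lt_of_lt_orCov (n := n) (m := m) (by omega) (by omega)
    have h2 := half_le_choose (m := m) (by omega)
    have h3 : 1 < m.choose ((m + 1) / 2 - 1) := by omega
    have h3' : (1 : ℝ) < m.choose ((m + 1) / 2 - 1) := by exact_mod_cast h3
    have h1' : (2 : ℝ) ^ m.choose ((m + 1) / 2 - 1) ≤ n := by exact_mod_cast h1.le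
    have hle : (m.choose ((m + 1) / 2 - 1) : ℝ) ≤ Real.logb 2 n := by
      rw [Real.le_logb_iff_rpow_le (by norm_num) (lt_of_lt_of_le (by positivity) h1'),
        Real.rpow_natCast]
      exact h1'
    have := logb_add_logb_logb_le h3' hle
    simp only [Function.comp_apply, hm, show m + 2 - 1 = m + 1 by omega, Nat.add_sub_cancel]
    push_cast
    linarith
end
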